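/- arXiv:1304.5083 — 2 statements merged into one kernel-verified Lean document; each statement's English description precedes it below -/
import Mathlib

section
/- For every n ≥ 1, the family of intervals I_{(i_1,…,i_n)}, indexed by the admissible n-tuples (i_1,…,i_n) of digits and defined by I_{(i_1,…,i_n)} = [p, p + γ^n) if i_n ≤ L−1 and I_{(i_1,…,i_n)} = [p, p + γ^{n+1}) if i_n ≥ L, where p = Σ_{k=1}^n b(i_k) γ^k, consists of pairwise disjoint intervals whose union is [0,1). In particular, the n-th LS-partition of [0,1) consists of l_n intervals of length γ^n and s_n intervals of length γ^{n+1}. -/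
/-- The coefficient `b(i)`: `b(i) = i` if `i ≤ L−1` and `b(i) = L + (i−L)γ` if `i ≥ L`. -/
noncomputable def bcoef (L : ℕ) (γ : ℝ) (i : ℕ) : ℝ :=
  if i < L then (i : ℝ) else (L : ℝ) + ((i : ℝ) - (L : ℝ)) * γ

/-- The left endpoint `p = Σ_{k=1}^n b(i_k) γ^k` attached to a tuple of digits. -/
noncomputable def lsPoint (L S : ℕ) (γ : ℝ) {n : ℕ} (i : Fin n → Fin (L + S)) : ℝ :=
  ∑ k : Fin n, bcoef L γ (i k : ℕ) * γ ^ ((k : ℕ) + 1)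

/-- The interval `I_{(i₁,…,iₙ)} = [p, p + γⁿ)` if `iₙ ≤ L−1`, and `[p, p + γ^{n+1})`
if `iₙ ≥ L`, attached to an `(n+1)`-tuple of digits. -/
noncomputable def lsInterval (L S : ℕ) (γ : ℝ) {n : ℕ} (i : Fin (n + 1) → Fin (L + S)) :
    Set ℝ :=
  Set.Ico (lsPoint L S γ i)
    (lsPoint L S γ i + if (i (Fin.last n) : ℕ) < L then γ ^ (n + 1) else γ ^ (n + 2))

/-- Admissibility of a tuple of digits: no pair of consecutive digits lies in `E_{L,S}`. -/
def LSAdmissible (L S : ℕ) {n : ℕ} (i : Fin n → Fin (L + S)) : Prop :=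
  ∀ h h' : Fin n, (h' : ℕ) = (h : ℕ) + 1 → ¬(L ≤ (i h : ℕ) ∧ 1 ≤ (i h' : ℕ))

lemma lsAdmissible_one {L S : ℕ} (i : Fin 1 → Fin (L + S)) : LSAdmissible L S i := by
  intro h h' hh
  omega

lemma lsAdmissible_snoc {L S n : ℕ} (i : Fin (n + 1) → Fin (L + S)) (j : Fin (L + S)) :
    LSAdmissible L S (Fin.snoc i j : Fin (n + 2) → Fin (L + S)) ↔
      LSAdmissible L S i ∧ ¬(L ≤ (i (Fin.last n) : ℕ) ∧ 1 ≤ (j : ℕ)) := by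
  constructor
  · intro H
    refine ⟨fun h h' hh => ?_, ?_⟩
    · simpa using H h.castSucc h'.castSucc (by simpa using hh)
    · simpa using H (Fin.last n).castSucc (Fin.last (n + 1)) (by simp)
  · rintro ⟨H, H'⟩ h h'
    induction h using Fin.lastCases with
    | last =>
      intro hh
      have := h'.isLt
      simp only [Fin.val_last] at hh
      omega
    | cast h =>
      induction h' using Fin.lastCases with
      | last =>
        intro hh
        obtain rfl : h = Fin.last n := by
          ext
          simpa using hh.symm
        simpa using H'
      | cast h' =>
        intro hh
        simpa using H h h' (by simpa using hh)

lemma bcoef_zero {L : ℕ} (hL : 1 ≤ L) (γ : ℝ) : bcoef L γ 0 = 0 := by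
  simp [bcoef, show 0 < L by omega]

lemma bcoef_succ (L : ℕ) (γ : ℝ) (j : ℕ) :
    bcoef L γ (j + 1) = bcoef L γ j + if j < L then 1 else γ := by
  unfold bcoef
  rcases lt_trichotomy (j + 1) L with h | h | h
  · simp [h, show j < L by omega]
  · subst h
    simp
  · simp only [show ¬ j + 1 < L by omega, show ¬ j < L by omega, if_false]
    push_cast
    ring

lemma bcoef_mono (L : ℕ) {γ : ℝ} (hγ : 0 ≤ γ) : Monotone (bcoef L γ) := by
  refine monotone_nat_of_le_succ fun j => ?_
  rw [bcoef_succ]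
  split_ifs <;> linarith

lemma bcoef_add_mul {L S : ℕ} {γ : ℝ} (h : (L : ℝ) * γ + (S : ℝ) * γ ^ 2 = 1) :
    bcoef L γ (L + S) * γ = 1 := by
  rw [← h]
  simp only [bcoef, show ¬ L + S < L by omega, if_false]
  push_cast
  ring

/-- The half-open intervals between consecutive values of a monotone sequence cover the whole. -/
lemma Monotone.mem_Ico_iff_exists_lt {f : ℕ → ℝ} (hf : Monotone f) (N : ℕ) (x : ℝ) :
    x ∈ Set.Ico (f 0) (f N) ↔ ∃ j : Fin N, x ∈ Set.Ico (f j) (f (j + 1)) := by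
  constructor
  · intro hx
    induction N with
    | zero => exact absurd hx (by simp)
    | succ N ih =>
      by_cases h : x < f N
      · obtain ⟨j, hj⟩ := ih ⟨hx.1, h⟩
        exact ⟨j.castSucc, by simpa using hj⟩
      · exact ⟨Fin.last N, by simpa using ⟨not_lt.1 h, hx.2⟩⟩
  · rintro ⟨j, h1, h2⟩
    exact ⟨(hf (Nat.zero_le _)).trans h1, h2.trans_le (hf j.isLt)⟩

lemma Monotone.eq_of_mem_Ico_succ {f : ℕ → ℝ} (hf : Monotone f) {j k : ℕ} {x : ℝ}
    (hj : x ∈ Set.Ico (f j) (f (j + 1))) (hk : x ∈ Set.Ico (f k) (f (k + 1))) : j = k := by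
  by_contra h
  exact Set.disjoint_left.1 (hf.pairwise_disjoint_on_Ico_succ h) hj hk

lemma lsInterval_one {L S : ℕ} (γ : ℝ) (i : Fin 1 → Fin (L + S)) :
    lsInterval L S γ i = Set.Ico (bcoef L γ (i 0) * γ) (bcoef L γ (i 0 + 1) * γ) := by
  have hp : lsPoint L S γ i = bcoef L γ (i 0) * γ := (Fin.sum_univ_one _).trans (by simp)
  change Set.Ico (lsPoint L S γ i)
    (lsPoint L S γ i + if (i 0 : ℕ) < L then γ ^ (0 + 1) else γ ^ (0 + 2)) = _
  rw [hp, bcoef_succ]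
  congr 1
  split_ifs <;> ring

lemma lsInterval_snoc {L S n : ℕ} (γ : ℝ) (i : Fin (n + 1) → Fin (L + S)) (j : Fin (L + S)) :
    lsInterval L S γ (Fin.snoc i j : Fin (n + 2) → Fin (L + S)) =
      Set.Ico (lsPoint L S γ i + bcoef L γ j * γ ^ (n + 2))
        (lsPoint L S γ i + bcoef L γ (j + 1) * γ ^ (n + 2)) := by
  have hp : lsPoint L S γ (Fin.snoc i j : Fin (n + 2) → Fin (L + S)) =
      lsPoint L S γ i + bcoef L γ j * γ ^ (n + 2) := by
    simp only [lsPoint]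
    rw [Fin.sum_univ_castSucc]
    simp
  rw [lsInterval, hp, bcoef_succ]
  congr 1
  simp only [Fin.snoc_last]
  split_ifs <;> ring

section Partition

variable {L S : ℕ} {γ : ℝ}

lemma monotone_add_bcoef_mul (hγ0 : 0 < γ) (p : ℝ) (m : ℕ) :
    Monotone fun j => p + bcoef L γ j * γ ^ m := fun j k h => by
  have := bcoef_mono L hγ0.le h
  dsimp only
  gcongr

/-- An admissible tuple's interval is the union of the intervals of its admissible extensions. -/
lemma mem_lsInterval_iff_exists_snoc (hL : 1 ≤ L) (hγ0 : 0 < γ)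
    (hγeq : (L : ℝ) * γ + (S : ℝ) * γ ^ 2 = 1) {n : ℕ} (i : Fin (n + 1) → Fin (L + S)) (x : ℝ) :
    x ∈ lsInterval L S γ i ↔ ∃ j : Fin (L + S), ¬(L ≤ (i (Fin.last n) : ℕ) ∧ 1 ≤ (j : ℕ)) ∧
      x ∈ lsInterval L S γ (Fin.snoc i j : Fin (n + 2) → Fin (L + S)) := by
  simp only [lsInterval_snoc]
  by_cases h : (i (Fin.last n) : ℕ) < L
  · have key := (monotone_add_bcoef_mul (L := L) hγ0 (lsPoint L S γ i) (n + 2)).mem_Ico_iff_exists_lt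
      (L + S) x
    have hend : bcoef L γ (L + S) * γ ^ (n + 2) = γ ^ (n + 1) := by
      rw [pow_succ', ← mul_assoc, bcoef_add_mul hγeq, one_mul]
    simp only [bcoef_zero hL, zero_mul, add_zero, hend] at key
    simpa [lsInterval, h, show ¬ L ≤ (i (Fin.last n) : ℕ) by omega] using key
  · have h1 : bcoef L γ (0 + 1) = 1 := by
      rw [bcoef_succ, bcoef_zero hL, if_pos (by omega), zero_add]
    have heq : lsInterval L S γ i = Set.Ico (lsPoint L S γ i + bcoef L γ 0 * γ ^ (n + 2))
        (lsPoint L S γ i + bcoef L γ (0 + 1) * γ ^ (n + 2)) := by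
      simp [lsInterval, h, h1, bcoef_zero hL]
    rw [heq]
    constructor
    · exact fun hx => ⟨⟨0, by omega⟩, by simp, hx⟩
    · rintro ⟨j, hj, hx⟩
      rwa [show (j : ℕ) = 0 by omega] at hx

lemma eq_of_mem_lsInterval_snoc (hγ0 : 0 < γ) {n : ℕ} (i : Fin (n + 1) → Fin (L + S))
    {j k : Fin (L + S)} {x : ℝ}
    (hj : x ∈ lsInterval L S γ (Fin.snoc i j : Fin (n + 2) → Fin (L + S)))
    (hk : x ∈ lsInterval L S γ (Fin.snoc i k : Fin (n + 2) → Fin (L + S))) : j = k := by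
  rw [lsInterval_snoc] at hj hk
  exact Fin.ext ((monotone_add_bcoef_mul hγ0 _ _).eq_of_mem_Ico_succ hj hk)

lemma exists_lsAdmissible_mem_lsInterval_iff (hL : 1 ≤ L) (hγ0 : 0 < γ)
    (hγeq : (L : ℝ) * γ + (S : ℝ) * γ ^ 2 = 1) (n : ℕ) (x : ℝ) :
    (∃ i : Fin (n + 1) → Fin (L + S), LSAdmissible L S i ∧ x ∈ lsInterval L S γ i) ↔
      x ∈ Set.Ico (0 : ℝ) 1 := by
  induction n with
  | zero =>
    have key := (monotone_add_bcoef_mul (L := L) hγ0 0 1).mem_Ico_iff_exists_lt (L + S) x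
    simp only [bcoef_zero hL, zero_mul, zero_add, pow_one, bcoef_add_mul hγeq] at key
    rw [key]
    constructor
    · rintro ⟨i, -, hx⟩
      exact ⟨i 0, by rwa [lsInterval_one] at hx⟩
    · rintro ⟨j, hx⟩
      exact ⟨fun _ => j, lsAdmissible_one _, by rwa [lsInterval_one]⟩
  | succ n ih =>
    rw [← ih]
    constructor
    · rintro ⟨i, hi, hx⟩
      rw [← Fin.snoc_init_self i] at hi hx
      rw [lsAdmissible_snoc] at hi
      exact ⟨Fin.init i, hi.1,
        (mem_lsInterval_iff_exists_snoc hL hγ0 hγeq _ x).2 ⟨_, hi.2, hx⟩⟩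
    · rintro ⟨i, hi, hx⟩
      obtain ⟨j, hj, hx⟩ := (mem_lsInterval_iff_exists_snoc hL hγ0 hγeq i x).1 hx
      exact ⟨Fin.snoc i j, (lsAdmissible_snoc i j).2 ⟨hi, hj⟩, hx⟩

lemma LSAdmissible.eq_of_mem_lsInterval (hL : 1 ≤ L) (hγ0 : 0 < γ)
    (hγeq : (L : ℝ) * γ + (S : ℝ) * γ ^ 2 = 1) {n : ℕ} {i i' : Fin (n + 1) → Fin (L + S)}
    (hi : LSAdmissible L S i) (hi' : LSAdmissible L S i') {x : ℝ}
    (hx : x ∈ lsInterval L S γ i) (hx' : x ∈ lsInterval L S γ i') : i = i' := by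
  induction n with
  | zero =>
    rw [lsInterval_one, ← pow_one γ] at hx hx'
    have h := (monotone_add_bcoef_mul (L := L) hγ0 0 1).eq_of_mem_Ico_succ
      (x := x) (j := i 0) (k := i' 0) (by simpa using hx) (by simpa using hx')
    funext k
    rw [Fin.fin_one_eq_zero k]
    exact Fin.ext h
  | succ n ih =>
    rw [← Fin.snoc_init_self i] at hi hx
    rw [← Fin.snoc_init_self i'] at hi' hx'
    rw [lsAdmissible_snoc] at hi hi'
    have h : Fin.init i = Fin.init i' := ih hi.1 hi'.1
      ((mem_lsInterval_iff_exists_snoc hL hγ0 hγeq _ x).2 ⟨_, hi.2, hx⟩)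
      ((mem_lsInterval_iff_exists_snoc hL hγ0 hγeq _ x).2 ⟨_, hi'.2, hx'⟩)
    rw [← h] at hx'
    rw [← Fin.snoc_init_self i, ← Fin.snoc_init_self i', ← h,
      eq_of_mem_lsInterval_snoc hγ0 _ hx hx']

end Partition

section Count

open Classical in
/-- The admissible tuples whose last digit is less than `L`. -/
noncomputable def lsLong (L S n : ℕ) : Finset (Fin (n + 1) → Fin (L + S)) :=
  Finset.univ.filter fun i => LSAdmissible L S i ∧ (i (Fin.last n) : ℕ) < L

open Classical in
/-- The admissible tuples whose last digit is at least `L`. -/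
noncomputable def lsShort (L S n : ℕ) : Finset (Fin (n + 1) → Fin (L + S)) :=
  Finset.univ.filter fun i => LSAdmissible L S i ∧ L ≤ (i (Fin.last n) : ℕ)

lemma card_fin_filter_lt (L S : ℕ) :
    (Finset.univ.filter fun j : Fin (L + S) => (j : ℕ) < L).card = L := by
  simp [Fin.card_filter_val_lt]

lemma card_fin_filter_ge (L S : ℕ) :
    (Finset.univ.filter fun j : Fin (L + S) => L ≤ (j : ℕ)).card = S := by
  have h := Finset.card_filter_add_card_filter_not (s := (Finset.univ : Finset (Fin (L + S))))
    (fun j => (j : ℕ) < L)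
  simp only [not_lt, card_fin_filter_lt, Finset.card_univ, Fintype.card_fin] at h
  omega

lemma card_lsLong_zero (L S : ℕ) : (lsLong L S 0).card = L := by
  refine (Finset.card_equiv (Equiv.funUnique (Fin 1) (Fin (L + S))) fun i => ?_).trans
    (card_fin_filter_lt L S)
  simp [lsLong, lsAdmissible_one]

lemma card_lsShort_zero (L S : ℕ) : (lsShort L S 0).card = S := by
  refine (Finset.card_equiv (Equiv.funUnique (Fin 1) (Fin (L + S))) fun i => ?_).trans
    (card_fin_filter_ge L S)
  simp [lsShort, lsAdmissible_one]

lemma card_lsLong_succ {L S : ℕ} (hL : 1 ≤ L) (n : ℕ) :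
    (lsLong L S (n + 1)).card = L * (lsLong L S n).card + (lsShort L S n).card := by
  classical
  have hdisj : Disjoint ((Finset.univ.filter fun j : Fin (L + S) => (j : ℕ) < L) ×ˢ lsLong L S n)
      (({⟨0, by omega⟩} : Finset (Fin (L + S))) ×ˢ lsShort L S n) := by
    refine Finset.disjoint_product.2 (Or.inr (Finset.disjoint_left.2 fun i hi hi' => ?_))
    simp only [lsLong, lsShort, Finset.mem_filter] at hi hi'
    omega
  have hcard := Finset.card_union_of_disjoint hdisj
  rw [Finset.card_product, Finset.card_product, card_fin_filter_lt, Finset.card_singleton,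
    one_mul] at hcard
  rw [← hcard]
  refine (Finset.card_equiv (Fin.snocEquiv fun _ => Fin (L + S)) fun ⟨j, i⟩ => ?_).symm
  simp only [lsLong, lsShort, Finset.mem_union, Finset.mem_product, Finset.mem_filter,
    Finset.mem_univ, true_and, Finset.mem_singleton, Fin.snocEquiv, Equiv.coe_fn_mk,
    lsAdmissible_snoc, Fin.snoc_last, Fin.ext_iff]
  by_cases hi : LSAdmissible L S i <;> simp only [hi, true_and, false_and, and_false, or_self]
  omega

lemma card_lsShort_succ {L S : ℕ} (hL : 1 ≤ L) (n : ℕ) :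
    (lsShort L S (n + 1)).card = S * (lsLong L S n).card := by
  classical
  have hcard := Finset.card_product (Finset.univ.filter fun j : Fin (L + S) => L ≤ (j : ℕ))
    (lsLong L S n)
  rw [card_fin_filter_ge] at hcard
  rw [← hcard]
  refine (Finset.card_equiv (Fin.snocEquiv fun _ => Fin (L + S)) fun ⟨j, i⟩ => ?_).symm
  simp only [lsLong, lsShort, Finset.mem_product, Finset.mem_filter, Finset.mem_univ, true_and,
    Fin.snocEquiv, Equiv.coe_fn_mk, lsAdmissible_snoc, Fin.snoc_last]
  by_cases hi : LSAdmissible L S i <;> simp only [hi, true_and, false_and, and_false]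
  omega

lemma card_lsLong_lsShort {L S : ℕ} (hL : 1 ≤ L) {l s : ℕ → ℕ} (hl0 : l 0 = 1) (hs0 : s 0 = 0)
    (hlrec : ∀ n : ℕ, l (n + 1) = L * l n + s n) (hsrec : ∀ n : ℕ, s (n + 1) = S * l n) (n : ℕ) :
    (lsLong L S n).card = l (n + 1) ∧ (lsShort L S n).card = s (n + 1) := by
  induction n with
  | zero => simp [card_lsLong_zero, card_lsShort_zero, hlrec, hsrec, hl0, hs0]
  | succ n ih =>
    rw [card_lsLong_succ hL, card_lsShort_succ hL, ih.1, ih.2, hlrec (n + 1), hsrec (n + 1)]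
    exact ⟨rfl, rfl⟩

end Count

/-- For every `n ≥ 1` (here `n+1`), the intervals `I_{(i₁,…,iₙ)}` indexed
by the admissible `n`-tuples of digits are pairwise disjoint and their union is `[0,1)`;
in particular the `n`-th LS-partition consists of `lₙ` intervals of length `γⁿ` and `sₙ`
intervals of length `γ^{n+1}`. -/
theorem stmt_7 (L S : ℕ) (hL : 1 ≤ L) (hLS : 2 ≤ L + S)
    (γ : ℝ) (hγ0 : 0 < γ) (hγ1 : γ < 1)
    (hγeq : (L : ℝ) * γ + (S : ℝ) * γ ^ 2 = 1)
    (l s : ℕ → ℕ) (hl0 : l 0 = 1) (hs0 : s 0 = 0)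
    (hlrec : ∀ n : ℕ, l (n + 1) = L * l n + s n)
    (hsrec : ∀ n : ℕ, s (n + 1) = S * l n) :
    ∀ n : ℕ,
      ({i : Fin (n + 1) → Fin (L + S) |
          ∀ h h' : Fin (n + 1), (h' : ℕ) = (h : ℕ) + 1 →
            ¬(L ≤ (i h : ℕ) ∧ 1 ≤ (i h' : ℕ))} : Set _).PairwiseDisjoint
        (lsInterval L S γ) ∧
      (⋃ i ∈ {i : Fin (n + 1) → Fin (L + S) |
          ∀ h h' : Fin (n + 1), (h' : ℕ) = (h : ℕ) + 1 →
            ¬(L ≤ (i h : ℕ) ∧ 1 ≤ (i h' : ℕ))}, lsInterval L S γ i)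
        = Set.Ico (0 : ℝ) 1 ∧
      (Finset.univ.filter fun i : Fin (n + 1) → Fin (L + S) =>
          (∀ h h' : Fin (n + 1), (h' : ℕ) = (h : ℕ) + 1 →
            ¬(L ≤ (i h : ℕ) ∧ 1 ≤ (i h' : ℕ))) ∧ (i (Fin.last n) : ℕ) < L).card
        = l (n + 1) ∧
      (Finset.univ.filter fun i : Fin (n + 1) → Fin (L + S) =>
          (∀ h h' : Fin (n + 1), (h' : ℕ) = (h : ℕ) + 1 →
            ¬(L ≤ (i h : ℕ) ∧ 1 ≤ (i h' : ℕ))) ∧ L ≤ (i (Fin.last n) : ℕ)).card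
        = s (n + 1) := by
  intro n
  obtain ⟨hl, hs⟩ := card_lsLong_lsShort hL hl0 hs0 hlrec hsrec n
  refine ⟨fun i hi i' hi' hne => Set.disjoint_left.2 fun x hx hx' => hne ?_, ?_, ?_, ?_⟩
  · exact LSAdmissible.eq_of_mem_lsInterval hL hγ0 hγeq hi hi' hx hx'
  · ext x
    rw [← exists_lsAdmissible_mem_lsInterval_iff hL hγ0 hγeq n x]
    simp only [Set.mem_iUnion, Set.mem_ofPred_eq, exists_prop, LSAdmissible]
  · rw [← hl]
    unfold lsLong LSAdmissible
    congr
  · rw [← hs]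
    unfold lsShort LSAdmissible
    congr
end

section
/- If S ≤ L, then there exist constants c, c' > 0 such that for every n ≥ 1, c' ≤ t_n · D(Λ^n_{L,S}) ≤ c, where Λ^n_{L,S} is the set of the t_n left endpoints of the n-th LS-partition. -/
/-- The set `Λⁿ_{L,S}` of left endpoints `Σ_{k=1}^n b(i_k)γᵏ` of the `n`-th LS-partition,
indexed by the admissible `n`-tuples of digits. -/
noncomputable def lamSet (L S : ℕ) (γ : ℝ) (n : ℕ) : Set ℝ :=
  {x : ℝ | ∃ i : Fin n → Fin (L + S),
    (∀ h h' : Fin n, (h' : ℕ) = (h : ℕ) + 1 → ¬(L ≤ (i h : ℕ) ∧ 1 ≤ (i h' : ℕ))) ∧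
    x = ∑ k : Fin n, bcoef L γ (i k : ℕ) * γ ^ ((k : ℕ) + 1)}

/-- The discrepancy of a finite set `Q ⊂ [0,1)` of `t` points:
`D(Q) = sup_{0 ≤ a < b ≤ 1} | (1/t)·#{y ∈ Q : y ∈ [a,b)} − (b−a) |`. -/
noncomputable def discSet (Q : Set ℝ) : ℝ :=
  sSup {d : ℝ | ∃ a b : ℝ, 0 ≤ a ∧ a < b ∧ b ≤ 1 ∧
    d = |((Q ∩ Set.Ico a b).ncard : ℝ) / (Q.ncard : ℝ) - (b - a)|}

open Set

lemma inter_Iio_eq_self {Q : Set ℝ} {x : ℝ} (h : ∀ z ∈ Q, z < x) : Q ∩ Iio x = Q :=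
  inter_eq_left.2 h

/-- The union of the translates `Q, Q + 1, …, Q + (m - 1)`. -/
def stack (Q : Set ℝ) (m : ℕ) : Set ℝ := {z | ∃ i < m, ∃ y ∈ Q, z = (i : ℝ) + y}

lemma stack_zero (Q : Set ℝ) : stack Q 0 = ∅ := by
  simp [stack]

lemma stack_succ (Q : Set ℝ) (m : ℕ) :
    stack Q (m + 1) = stack Q m ∪ (fun w => (m : ℝ) + 1 * w) '' Q := by
  ext z
  simp only [stack, mem_ofPred_eq, mem_union, mem_image, one_mul, Nat.lt_succ_iff_lt_or_eq]
  constructor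
  · rintro ⟨i, hi | rfl, y, hy, rfl⟩
    · exact Or.inl ⟨i, hi, y, hy, rfl⟩
    · exact Or.inr ⟨y, hy, rfl⟩
  · rintro (⟨i, hi, y, hy, rfl⟩ | ⟨y, hy, rfl⟩)
    · exact ⟨i, Or.inl hi, y, hy, rfl⟩
    · exact ⟨m, Or.inr rfl, y, hy, rfl⟩

lemma stack_finite {Q : Set ℝ} (hQ : Q.Finite) (m : ℕ) : (stack Q m).Finite := by
  induction m with
  | zero => simp [stack_zero]
  | succ m ih => rw [stack_succ]; exact ih.union (hQ.image _)

lemma stack_subset {Q : Set ℝ} (hQ : Q ⊆ Ico 0 1) (m : ℕ) : stack Q m ⊆ Ico 0 (m : ℝ) := by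
  rintro _ ⟨i, hi, y, hy, rfl⟩
  obtain ⟨h0, h1⟩ := hQ hy
  have : (i : ℝ) + 1 ≤ m := by exact_mod_cast hi
  exact ⟨by positivity, by linarith⟩

lemma ncard_affine_inter_Iio (Q : Set ℝ) (c : ℝ) {s : ℝ} (hs : 0 < s) (x : ℝ) :
    (((fun w => c + s * w) '' Q) ∩ Iio x).ncard = (Q ∩ Iio ((x - c) / s)).ncard := by
  have hinj : Function.Injective (fun w : ℝ => c + s * w) := fun a b h => by
    simpa [hs.ne'] using h
  rw [← ncard_image_of_injective (Q ∩ Iio ((x - c) / s)) hinj, image_inter hinj]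
  congr 1
  ext z
  simp only [mem_inter_iff, mem_image, mem_Iio]
  refine and_congr_right fun _ => ⟨fun hz => ⟨(z - c) / s, by gcongr, by field_simp; ring⟩, ?_⟩
  rintro ⟨w, hw, rfl⟩
  rw [lt_div_iff₀ hs] at hw
  linarith

lemma ncard_union_inter {A B : Set ℝ} (hA : A.Finite) (hB : B.Finite) {p : ℝ}
    (hAp : ∀ z ∈ A, z < p) (hBp : ∀ z ∈ B, p ≤ z) (I : Set ℝ) :
    ((A ∪ B) ∩ I).ncard = (A ∩ I).ncard + (B ∩ I).ncard := by
  rw [union_inter_distrib_right]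
  refine ncard_union_eq ?_ (hA.inter_of_left _) (hB.inter_of_left _)
  rw [disjoint_left]
  exact fun z hz hz' => (hAp z hz.1).not_ge (hBp z hz'.1)

lemma ncard_stack_inter_Iio {Q : Set ℝ} (hf : Q.Finite) (hQ : Q ⊆ Ico 0 1) (m : ℕ) (u : ℝ) :
    (stack Q m ∩ Iio u).ncard = ∑ i ∈ Finset.range m, (Q ∩ Iio (u - i)).ncard := by
  induction m with
  | zero => simp [stack_zero]
  | succ m ih =>
    rw [stack_succ, ncard_union_inter (p := m) (stack_finite hf m) (hf.image _)
      (fun z hz => (stack_subset hQ m hz).2), ih, ncard_affine_inter_Iio _ _ one_pos,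
      Finset.sum_range_succ, div_one]
    rintro _ ⟨w, hw, rfl⟩
    have := (hQ hw).1
    simpa using this

/-- One step of the LS-refinement: `L` copies of `A` scaled by `γ` followed by `S` copies of `B`
scaled by `γ ^ 2`. -/
def lsRefine (L S : ℕ) (γ : ℝ) (A B : Set ℝ) : Set ℝ :=
  (fun w => 0 + γ * w) '' (stack A L ∪ (fun w => (L : ℝ) + γ * w) '' stack B S)

lemma mem_lsRefine {L S : ℕ} {γ : ℝ} {A B : Set ℝ} {z : ℝ} :
    z ∈ lsRefine L S γ A B ↔ (∃ i < L, ∃ y ∈ A, z = γ * (i + y)) ∨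
      ∃ j < S, ∃ y ∈ B, z = γ * (L + γ * (j + y)) := by
  simp only [lsRefine, stack, mem_image, mem_union, mem_ofPred_eq, zero_add]
  constructor
  · rintro ⟨_, ⟨i, hi, y, hy, rfl⟩ | ⟨_, ⟨j, hj, y, hy, rfl⟩, rfl⟩, rfl⟩
    · exact Or.inl ⟨i, hi, y, hy, rfl⟩
    · exact Or.inr ⟨j, hj, y, hy, rfl⟩
  · rintro (⟨i, hi, y, hy, rfl⟩ | ⟨j, hj, y, hy, rfl⟩)
    · exact ⟨_, Or.inl ⟨i, hi, y, hy, rfl⟩, rfl⟩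
    · exact ⟨_, Or.inr ⟨_, ⟨j, hj, y, hy, rfl⟩, rfl⟩, rfl⟩

section refinement

variable {L S : ℕ} {γ : ℝ} {A B : Set ℝ}

lemma lsRefine_finite (hA : A.Finite) (hB : B.Finite) : (lsRefine L S γ A B).Finite :=
  ((stack_finite hA L).union ((stack_finite hB S).image _)).image _

lemma lsRefine_subset (hγ : 0 < γ) (hγeq : (L : ℝ) * γ + (S : ℝ) * γ ^ 2 = 1)
    (hA : A ⊆ Ico 0 1) (hB : B ⊆ Ico 0 1) : lsRefine L S γ A B ⊆ Ico 0 1 := by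
  rintro _ ⟨w, hw | ⟨v, hv, rfl⟩, rfl⟩
  · obtain ⟨h0, h1⟩ := stack_subset hA L hw
    have : γ * w < γ * L := by gcongr
    have : 0 ≤ (S : ℝ) * γ ^ 2 := by positivity
    exact ⟨by positivity, by simp only; linarith⟩
  · obtain ⟨h0, h1⟩ := stack_subset hB S hv
    have : γ ^ 2 * v < γ ^ 2 * S := by gcongr
    exact ⟨by positivity, by simp only; linarith⟩

lemma ncard_lsRefine_inter_Iio (hγ : 0 < γ) (hAf : A.Finite) (hBf : B.Finite)
    (hA : A ⊆ Ico 0 1) (hB : B ⊆ Ico 0 1) (x : ℝ) :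
    (lsRefine L S γ A B ∩ Iio x).ncard =
      ∑ i ∈ Finset.range L, (A ∩ Iio (x / γ - i)).ncard +
      ∑ j ∈ Finset.range S, (B ∩ Iio ((x / γ - L) / γ - j)).ncard := by
  rw [lsRefine, ncard_affine_inter_Iio _ _ hγ, sub_zero, ncard_union_inter (p := L)
    (stack_finite hAf L) ((stack_finite hBf S).image _) (fun z hz => (stack_subset hA L hz).2),
    ncard_stack_inter_Iio hAf hA, ncard_affine_inter_Iio _ _ hγ, ncard_stack_inter_Iio hBf hB]
  rintro _ ⟨w, hw, rfl⟩
  have := (stack_subset hB S hw).1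
  simp only
  nlinarith

end refinement

/-- `Q` consists of `T` points of `[0,1)` whose counting function on the intervals `[0,x)` deviates
from `T x` by at most `M`. -/
structure WellSpread (Q : Set ℝ) (T : ℕ) (M : ℝ) : Prop where
  finite : Q.Finite
  subset : Q ⊆ Ico 0 1
  ncard_eq : Q.ncard = T
  abs_count_sub_le : ∀ x ∈ Icc (0 : ℝ) 1, |((Q ∩ Iio x).ncard : ℝ) - T * x| ≤ M

namespace WellSpread

variable {Q : Set ℝ} {T : ℕ} {M : ℝ}

lemma count_of_nonpos (h : WellSpread Q T M) {x : ℝ} (hx : x ≤ 0) : (Q ∩ Iio x).ncard = 0 := by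
  have : Q ∩ Iio x = ∅ := by
    ext z
    simp only [mem_inter_iff, mem_Iio, mem_empty_iff_false, iff_false, not_and, not_lt]
    exact fun hz => hx.trans (h.subset hz).1
  simp [this]

lemma count_of_one_le (h : WellSpread Q T M) {x : ℝ} (hx : 1 ≤ x) : (Q ∩ Iio x).ncard = T := by
  rw [inter_Iio_eq_self fun z hz => (h.subset hz).2.trans_le hx, h.ncard_eq]

lemma sum_count_of_le (h : WellSpread Q T M) {m : ℕ} {u : ℝ} (hu : (m : ℝ) ≤ u) :
    ∑ i ∈ Finset.range m, (Q ∩ Iio (u - i)).ncard = m * T := by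
  rw [Finset.sum_congr rfl (g := fun _ => T)]
  · simp
  · intro i hi
    have : (i : ℝ) + 1 ≤ m := by exact_mod_cast Finset.mem_range.1 hi
    exact h.count_of_one_le (by linarith)

lemma sum_count_of_nonpos (h : WellSpread Q T M) (m : ℕ) {u : ℝ} (hu : u ≤ 0) :
    ∑ i ∈ Finset.range m, (Q ∩ Iio (u - i)).ncard = 0 :=
  Finset.sum_eq_zero fun i _ => h.count_of_nonpos (by
    have : (0 : ℝ) ≤ i := i.cast_nonneg
    linarith)

lemma abs_sum_count_sub_le (h : WellSpread Q T M) (m : ℕ) {u : ℝ} (h0 : 0 ≤ u) (hu : u ≤ m) :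
    |((∑ i ∈ Finset.range m, (Q ∩ Iio (u - i)).ncard : ℕ) : ℝ) - T * u| ≤ M := by
  induction m with
  | zero =>
    have hu0 : u = 0 := le_antisymm (by simpa using hu) h0
    simpa [hu0] using (abs_nonneg _).trans (h.abs_count_sub_le 0 (by simp))
  | succ m ih =>
    rw [Finset.sum_range_succ]
    rcases le_total u m with hum | hum
    · rw [h.count_of_nonpos (x := u - m) (by linarith), add_zero]
      exact ih hum
    · push_cast at hu
      rw [h.sum_count_of_le hum]
      have := h.abs_count_sub_le (u - m) ⟨by linarith, by linarith⟩
      push_cast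
      convert this using 2
      ring

lemma singleton : WellSpread {0} 1 1 where
  finite := finite_singleton 0
  subset := by simp
  ncard_eq := by simp
  abs_count_sub_le := by
    rintro x ⟨h0, h1⟩
    rcases h0.eq_or_lt with rfl | h0
    · simp
    · rw [inter_eq_left.2 (by simpa using h0)]
      simp only [ncard_singleton, Nat.cast_one, one_mul]
      rw [abs_le]
      constructor <;> linarith

protected lemma lsRefine {L S : ℕ} {γ : ℝ} (hγ : 0 < γ) (hγeq : (L : ℝ) * γ + (S : ℝ) * γ ^ 2 = 1)
    {A B : Set ℝ} {TA TB T : ℕ} {MA MB dA dB : ℝ} (hA : WellSpread A TA MA) (hB : WellSpread B TB MB)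
    (hγ1 : γ ≤ 1) (hT : T = L * TA + S * TB)
    (hdA : |(TA : ℝ) - γ * T| ≤ dA) (hdB : |(TB : ℝ) - γ * TA| ≤ dB)
    (hM₁ : MA + L * dA ≤ M) (hM₂ : MB + L * dA + S * (dB + dA) ≤ M) :
    WellSpread (lsRefine L S γ A B) T M where
  finite := lsRefine_finite hA.finite hB.finite
  subset := lsRefine_subset hγ hγeq hA.subset hB.subset
  ncard_eq := by
    have hL : (1 / γ - L) / γ = S := by
      field_simp
      linarith
    have h1 : (L : ℝ) ≤ 1 / γ := by
      rw [le_div_iff₀ hγ]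
      have : 0 ≤ (S : ℝ) * γ ^ 2 := by positivity
      linarith
    have := ncard_lsRefine_inter_Iio (L := L) (S := S) hγ hA.finite hB.finite hA.subset hB.subset 1
    rw [inter_Iio_eq_self fun z hz => (lsRefine_subset hγ hγeq hA.subset hB.subset hz).2] at this
    rw [this, hA.sum_count_of_le h1, hB.sum_count_of_le hL.ge, hT]
  abs_count_sub_le := by
    rintro x ⟨h0, h1⟩
    rw [ncard_lsRefine_inter_Iio hγ hA.finite hB.finite hA.subset hB.subset]
    obtain ⟨u, rfl⟩ : ∃ u, x = γ * u := ⟨x / γ, by field_simp⟩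
    have hu0 : 0 ≤ u := nonneg_of_mul_nonneg_right h0 hγ
    rw [mul_div_cancel_left₀ _ hγ.ne']
    rcases le_total u L with hu | hu
    · rw [hB.sum_count_of_nonpos S (div_nonpos_of_nonpos_of_nonneg (by linarith) hγ.le), add_zero]
      have hc := hA.abs_sum_count_sub_le L hu0 hu
      have hd : |u * ((TA : ℝ) - γ * T)| ≤ L * dA := by
        rw [abs_mul, abs_of_nonneg hu0]
        gcongr
      calc _ = |((∑ i ∈ Finset.range L, (A ∩ Iio (u - i)).ncard : ℕ) - TA * u)
              + u * ((TA : ℝ) - γ * T)| := by congr 1; ring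
        _ ≤ _ := (abs_add_le _ _).trans (by linarith)
    · rw [hA.sum_count_of_le hu]
      obtain ⟨w, rfl⟩ : ∃ w, u = L + γ * w := ⟨(u - L) / γ, by field_simp; ring⟩
      have hw0 : 0 ≤ w := nonneg_of_mul_nonneg_right (a := γ) (by linarith) hγ
      have hwS : w ≤ S := by
        have : γ ^ 2 * w ≤ γ ^ 2 * S := by linarith
        exact le_of_mul_le_mul_left this (by positivity)
      rw [add_sub_cancel_left, mul_div_cancel_left₀ _ hγ.ne']
      have hc := hB.abs_sum_count_sub_le S hw0 hwS
      have hd : |(L : ℝ) * ((TA : ℝ) - γ * T)| ≤ L * dA := by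
        rw [abs_mul, Nat.abs_cast]
        gcongr
      have he : |w * (((TB : ℝ) - γ * TA) + γ * ((TA : ℝ) - γ * T))| ≤ S * (dB + dA) := by
        rw [abs_mul, abs_of_nonneg hw0]
        gcongr
        refine (abs_add_le _ _).trans ?_
        rw [abs_mul, abs_of_pos hγ]
        have : γ * |(TA : ℝ) - γ * T| ≤ 1 * |(TA : ℝ) - γ * T| := by gcongr
        linarith
      calc _ = |((∑ i ∈ Finset.range S, (B ∩ Iio (w - i)).ncard : ℕ) - TB * w)
              + (L : ℝ) * ((TA : ℝ) - γ * T)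
              + w * (((TB : ℝ) - γ * TA) + γ * ((TA : ℝ) - γ * T))| := by
            congr 1
            push_cast
            ring
        _ ≤ _ := (abs_add_three _ _ _).trans (by linarith)

end WellSpread

lemma balanced_of_recursion {L S : ℕ} {γ : ℝ} (hγ : 0 < γ) (hγ1 : γ < 1)
    (hγeq : (L : ℝ) * γ + (S : ℝ) * γ ^ 2 = 1) {P : ℕ → Set ℝ} {T : ℕ → ℕ}
    (hP0 : P 0 = {0}) (hP1 : P 1 = {0}) (hP : ∀ n, P (n + 2) = lsRefine L S γ (P (n + 1)) (P n))
    (hT0 : T 0 = 1) (hT1 : T 1 = 1) (hT : ∀ n, T (n + 2) = L * T (n + 1) + S * T n) (n : ℕ) :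
    WellSpread (P n) (T n) (1 + (L + S) * ∑ k ∈ Finset.range n, (S * γ) ^ k) := by
  have hdef : ∀ n, (T n : ℝ) - γ * T (n + 1) = (-(S * γ)) ^ n * (1 - γ) := by
    intro n
    induction n with
    | zero => simp [hT0, hT1]
    | succ n ih =>
      rw [pow_succ, mul_right_comm, ← ih, hT]
      push_cast
      linear_combination (-(T (n + 1) : ℝ)) * hγeq
  have habs : ∀ n, |(T n : ℝ) - γ * T (n + 1)| ≤ (S * γ) ^ n := by
    intro n
    rw [hdef, abs_mul, abs_pow, abs_neg, abs_of_nonneg (by positivity : 0 ≤ (S : ℝ) * γ),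
      abs_of_pos (by linarith)]
    exact mul_le_of_le_one_right (by positivity) (by linarith)
  have hr : 0 ≤ (S : ℝ) * γ := by positivity
  induction n using Nat.twoStepInduction with
  | zero => simpa [hP0, hT0] using WellSpread.singleton
  | one =>
    rw [hP1, hT1]
    refine ⟨finite_singleton 0, by simp, by simp, fun x hx => ?_⟩
    refine (WellSpread.singleton.abs_count_sub_le x hx).trans ?_
    simp only [Finset.range_one, Finset.sum_singleton, pow_zero, mul_one]
    linarith [(L.cast_nonneg : (0 : ℝ) ≤ L), (S.cast_nonneg : (0 : ℝ) ≤ S)]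
  | more n ihB ihA =>
    rw [hP]
    refine WellSpread.lsRefine hγ hγeq ihA ihB hγ1.le (hT n) (habs (n + 1)) (habs n) ?_ ?_
    · rw [Finset.sum_range_succ _ (n + 1)]
      have : 0 ≤ (S : ℝ) * (S * γ) ^ (n + 1) := by positivity
      linarith
    · rw [Finset.sum_range_succ _ (n + 1), Finset.sum_range_succ _ n]
      have : 0 ≤ (L : ℝ) * (S * γ) ^ n := by positivity
      linarith

lemma WellSpread.abs_count_Ico_le {Q : Set ℝ} {T : ℕ} {M : ℝ} (h : WellSpread Q T M) (hT : 0 < T)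
    {a b : ℝ} (ha : 0 ≤ a) (hab : a < b) (hb : b ≤ 1) :
    |((Q ∩ Ico a b).ncard : ℝ) / Q.ncard - (b - a)| ≤ 2 * M / T := by
  have hsplit : (Q ∩ Iio b).ncard = (Q ∩ Iio a).ncard + (Q ∩ Ico a b).ncard := by
    rw [← ncard_union_eq _ (h.finite.inter_of_left _) (h.finite.inter_of_left _),
      ← inter_union_distrib_left, Iio_union_Ico_eq_Iio hab.le]
    rw [disjoint_left]
    exact fun z hz hz' => (mem_Iio.1 hz.2).not_ge hz'.2.1
  have hsplit' : ((Q ∩ Iio b).ncard : ℝ) = (Q ∩ Iio a).ncard + (Q ∩ Ico a b).ncard := by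
    exact_mod_cast hsplit
  have hT' : (0 : ℝ) < T := by exact_mod_cast hT
  rw [h.ncard_eq, le_div_iff₀ hT', ← abs_of_pos hT', ← abs_mul, abs_of_pos hT', sub_mul,
    div_mul_cancel₀ _ hT'.ne']
  have h1 := abs_le.1 (h.abs_count_sub_le a ⟨ha, by linarith⟩)
  have h2 := abs_le.1 (h.abs_count_sub_le b ⟨by linarith, hb⟩)
  rw [abs_le]
  constructor <;> linarith

lemma WellSpread.mul_discSet_le {Q : Set ℝ} {T : ℕ} {M : ℝ} (h : WellSpread Q T M) (hT : 0 < T) :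
    T * discSet Q ≤ 2 * M := by
  have hT' : (0 : ℝ) < T := by exact_mod_cast hT
  rw [mul_comm, ← le_div_iff₀ hT']
  refine csSup_le ⟨_, 0, 1, le_rfl, one_pos, le_rfl, rfl⟩ ?_
  rintro _ ⟨a, b, ha, hab, hb, rfl⟩
  exact h.abs_count_Ico_le hT ha hab hb

lemma WellSpread.half_le_mul_discSet {Q : Set ℝ} {T : ℕ} {M : ℝ} (h : WellSpread Q T M)
    (hT : 0 < T) (h0 : (0 : ℝ) ∈ Q) : 1 / 2 ≤ T * discSet Q := by
  have hT' : (1 : ℝ) ≤ T := by exact_mod_cast hT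
  have hT0 : (0 : ℝ) < T := by linarith
  set ε : ℝ := 1 / (2 * T)
  have hε0 : 0 < ε := by positivity
  have hε1 : ε ≤ 1 := by
    rw [div_le_one (by positivity)]
    linarith
  have hbdd : BddAbove {d : ℝ | ∃ a b : ℝ, 0 ≤ a ∧ a < b ∧ b ≤ 1 ∧
      d = |((Q ∩ Ico a b).ncard : ℝ) / (Q.ncard : ℝ) - (b - a)|} := by
    refine ⟨2 * M / T, ?_⟩
    rintro _ ⟨a, b, ha, hab, hb, rfl⟩
    exact h.abs_count_Ico_le hT ha hab hb
  have hle : |((Q ∩ Ico 0 ε).ncard : ℝ) / Q.ncard - (ε - 0)| ≤ discSet Q :=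
    le_csSup hbdd ⟨0, ε, le_rfl, hε0, hε1, rfl⟩
  have hcard : (1 : ℝ) ≤ (Q ∩ Ico 0 ε).ncard := by
    exact_mod_cast (ncard_pos (h.finite.inter_of_left _)).2 ⟨0, h0, left_mem_Ico.2 hε0⟩
  have h1 : 1 / (T : ℝ) ≤ (Q ∩ Ico 0 ε).ncard / Q.ncard := by
    rw [h.ncard_eq]
    gcongr
  have h2 : 1 / (2 * (T : ℝ)) ≤ discSet Q := by
    have : 1 / (T : ℝ) = ε + ε := by simp only [ε]; field_simp; norm_num
    exact le_trans (by linarith) ((le_abs_self _).trans hle)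
  calc (1 : ℝ) / 2 = T * (1 / (2 * T)) := by field_simp
    _ ≤ _ := by gcongr

/-- Admissibility of a tuple of digits. -/
def Admissible (L S n : ℕ) (i : Fin n → Fin (L + S)) : Prop :=
  ∀ h h' : Fin n, (h' : ℕ) = (h : ℕ) + 1 → ¬(L ≤ (i h : ℕ) ∧ 1 ≤ (i h' : ℕ))

/-- The point with digit expansion `i`. -/
noncomputable def digitSum (L S : ℕ) (γ : ℝ) (n : ℕ) (i : Fin n → Fin (L + S)) : ℝ :=
  ∑ k : Fin n, bcoef L γ (i k : ℕ) * γ ^ ((k : ℕ) + 1)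

section digits

variable {L S : ℕ} {γ : ℝ}

lemma mem_lamSet {n : ℕ} {x : ℝ} :
    x ∈ lamSet L S γ n ↔ ∃ i, Admissible L S n i ∧ x = digitSum L S γ n i := Iff.rfl

lemma admissible_cons {n : ℕ} (a : Fin (L + S)) (f : Fin n → Fin (L + S)) :
    Admissible L S (n + 1) (Fin.cons a f) ↔
      (∀ h : Fin n, (h : ℕ) = 0 → L ≤ (a : ℕ) → (f h : ℕ) = 0) ∧ Admissible L S n f := by
  simp only [Admissible, Fin.forall_fin_succ, Fin.cons_zero, Fin.cons_succ, Fin.val_succ,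
    Fin.val_zero]
  grind

lemma digitSum_cons {n : ℕ} (a : Fin (L + S)) (f : Fin n → Fin (L + S)) :
    digitSum L S γ (n + 1) (Fin.cons a f) = γ * (bcoef L γ a + digitSum L S γ n f) := by
  simp only [digitSum, Fin.sum_univ_succ, Fin.cons_zero, Fin.cons_succ, Fin.val_succ,
    Fin.val_zero, mul_add, Finset.mul_sum]
  congr 1
  · ring
  · exact Finset.sum_congr rfl fun _ _ => by ring

lemma lamSet_zero : lamSet L S γ 0 = {0} := by
  ext x
  simp [mem_lamSet, Admissible, digitSum]

lemma mem_lamSet_succ {n : ℕ} {x : ℝ} :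
    x ∈ lamSet L S γ (n + 1) ↔ ∃ (a : Fin (L + S)) (f : Fin n → Fin (L + S)),
      ((∀ h : Fin n, (h : ℕ) = 0 → L ≤ (a : ℕ) → (f h : ℕ) = 0) ∧ Admissible L S n f) ∧
      x = γ * (bcoef L γ a + digitSum L S γ n f) := by
  rw [mem_lamSet, Fin.exists_fin_succ_pi]
  simp only [admissible_cons, digitSum_cons]

lemma bcoef_of_lt {i : ℕ} (h : i < L) : bcoef L γ i = i := if_pos h

lemma bcoef_add (j : ℕ) : bcoef L γ (L + j) = L + j * γ := by
  simp [bcoef]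

lemma lamSet_one : lamSet L S γ 1 = lsRefine L S γ (lamSet L S γ 0) {0} := by
  ext x
  rw [mem_lamSet_succ, mem_lsRefine, lamSet_zero]
  simp only [Admissible, digitSum, mem_singleton_iff, exists_eq_left, IsEmpty.forall_iff, and_self,
    true_and, Finset.univ_eq_empty, Finset.sum_empty, add_zero, exists_const]
  constructor
  · rintro ⟨a, rfl⟩
    rcases lt_or_ge (a : ℕ) L with ha | ha
    · exact Or.inl ⟨a, ha, by rw [bcoef_of_lt ha]⟩
    · obtain ⟨j, hj⟩ := Nat.exists_eq_add_of_le ha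
      exact Or.inr ⟨j, by omega, by rw [hj, bcoef_add]; ring⟩
  · rintro (⟨i, hi, rfl⟩ | ⟨j, hj, rfl⟩)
    · exact ⟨⟨i, by omega⟩, by rw [bcoef_of_lt hi]⟩
    · exact ⟨⟨L + j, by omega⟩, by rw [bcoef_add]; ring⟩

lemma lamSet_add_two (hL : 1 ≤ L) (n : ℕ) :
    lamSet L S γ (n + 2) = lsRefine L S γ (lamSet L S γ (n + 1)) (lamSet L S γ n) := by
  have hb0 : bcoef L γ 0 = 0 := by simpa using bcoef_of_lt (γ := γ) hL
  ext x
  rw [mem_lamSet_succ, mem_lsRefine]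
  constructor
  · rintro ⟨a, f, ⟨hhead, hf⟩, rfl⟩
    rcases lt_or_ge (a : ℕ) L with ha | ha
    · exact Or.inl ⟨a, ha, _, mem_lamSet.2 ⟨f, hf, rfl⟩, by rw [bcoef_of_lt ha]⟩
    · obtain ⟨j, hj⟩ := Nat.exists_eq_add_of_le ha
      obtain ⟨c, g, rfl⟩ : ∃ c g, f = Fin.cons c g := ⟨f 0, Fin.tail f, (Fin.cons_self_tail f).symm⟩
      have hc : (c : ℕ) = 0 := by simpa using hhead 0 rfl ha
      refine Or.inr ⟨j, by omega, _, mem_lamSet.2 ⟨g, ((admissible_cons _ _).1 hf).2, rfl⟩, ?_⟩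
      rw [digitSum_cons, hc, hj, bcoef_add, hb0]
      ring
  · rintro (⟨i, hi, y, hy, rfl⟩ | ⟨j, hj, y, hy, rfl⟩)
    · obtain ⟨f, hf, rfl⟩ := mem_lamSet.1 hy
      refine ⟨⟨i, by omega⟩, f, ⟨fun _ _ h => ?_, hf⟩, by rw [bcoef_of_lt hi]⟩
      exact absurd hi (not_lt.2 h)
    · obtain ⟨f, hf, rfl⟩ := mem_lamSet.1 hy
      refine ⟨⟨L + j, by omega⟩, Fin.cons ⟨0, by omega⟩ f, ⟨fun h h0 _ => ?_, ?_⟩, ?_⟩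
      · rw [show h = 0 from Fin.ext h0, Fin.cons_zero]
      · exact (admissible_cons _ _).2 ⟨fun _ _ h => absurd h (by simp; omega), hf⟩
      · rw [digitSum_cons, bcoef_add, hb0]
        ring

lemma zero_mem_lamSet (hL : 1 ≤ L) (n : ℕ) : (0 : ℝ) ∈ lamSet L S γ n := by
  have hb0 : bcoef L γ 0 = 0 := by simpa using bcoef_of_lt (γ := γ) hL
  refine mem_lamSet.2 ⟨fun _ => ⟨0, by omega⟩, fun _ _ _ h => by simp at h, ?_⟩
  simp [digitSum, hb0]

end digits

/-- If `S ≤ L`, there exist constants `c, c' > 0` such that for every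
`n ≥ 1` (here `n+1`), `c' ≤ tₙ · D(Λⁿ_{L,S}) ≤ c`. -/
theorem stmt_10 (L S : ℕ) (hL : 1 ≤ L) (hLS : 2 ≤ L + S) (hSL : S ≤ L)
    (γ : ℝ) (hγ0 : 0 < γ) (hγ1 : γ < 1)
    (hγeq : (L : ℝ) * γ + (S : ℝ) * γ ^ 2 = 1)
    (t : ℕ → ℕ) (ht0 : t 0 = 1) (ht1 : t 1 = L + S)
    (htrec : ∀ n : ℕ, t (n + 2) = L * t (n + 1) + S * t n) :
    ∃ c > (0 : ℝ), ∃ c' > (0 : ℝ), ∀ n : ℕ,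
      c' ≤ (t (n + 1) : ℝ) * discSet (lamSet L S γ (n + 1)) ∧
      (t (n + 1) : ℝ) * discSet (lamSet L S γ (n + 1)) ≤ c := by
  have hr0 : 0 ≤ (S : ℝ) * γ := by positivity
  have hr1 : (S : ℝ) * γ < 1 := by
    rcases S.eq_zero_or_pos with rfl | hS
    · simp
    · have h1 : (S : ℝ) * γ ≤ L * γ := by gcongr
      have h2 : 0 < (S : ℝ) * γ ^ 2 := by positivity
      linarith
  let P : ℕ → Set ℝ := fun n => Nat.casesOn n {0} (lamSet L S γ)
  let T : ℕ → ℕ := fun n => Nat.casesOn n 1 t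
  have hbal : ∀ n, WellSpread (P n) (T n) (1 + (L + S) * ∑ k ∈ Finset.range n, (S * γ) ^ k) := by
    refine balanced_of_recursion hγ0 hγ1 hγeq rfl lamSet_zero (fun n => ?_) rfl ht0 fun n => ?_
    · cases n with
      | zero => exact lamSet_one
      | succ n => exact lamSet_add_two hL n
    · cases n with
      | zero => exact ht1.trans (by simp [T, ht0])
      | succ n => exact htrec n
  have hpos : ∀ n, 0 < t n := by
    intro n
    induction n using Nat.twoStepInduction with
    | zero => omega
    | one => omega
    | more n _ ih =>
      rw [htrec]
      exact Nat.add_pos_left (Nat.mul_pos hL ih) _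
  refine ⟨2 * (1 + (L + S) * (1 - S * γ)⁻¹), ?_, 1 / 2, by norm_num, fun n => ⟨?_, ?_⟩⟩
  · have : 0 < 1 - (S : ℝ) * γ := by linarith
    positivity
  · exact (hbal (n + 2)).half_le_mul_discSet (hpos _) (zero_mem_lamSet hL _)
  · refine ((hbal (n + 2)).mul_discSet_le (hpos _)).trans ?_
    gcongr
    rw [← tsum_geometric_of_lt_one hr0 hr1]
    exact (summable_geometric_of_lt_one hr0 hr1).sum_le_tsum _ fun _ _ => by positivity
end
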